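/- There is an absolute constant C₀ ≥ 1 such that the following holds. Let n, m ≥ 1, let p ≥ 2 be even, let q be an integer with 1 ≤ q ≤ p−1, let C > 0, let μ be a finitely supported probability measure on ℝ^n × ℝ^m with a finite mixture presentation (λ_t, μ'_t)_{t ≤ N}, define truncations ũ_i, ṽ_j from μ and C, and let A : Fin n → Fin m → ℝ. Then: (a) |∑_t λ_t · ∑_{i,j} 𝔼_{μ'_t}[(A i j)^q·((ũ_i ṽ_j)^{p−q} − (u_i v_j)^{p−q})]| ≤ (C₀/C^q)·(∑_{i,j}(A i j)^p)^{q/p}·(∑_{i,j}𝔼_μ[(u_i v_j)^p])^{(p−q)/p}; and (b) if in addition every μ'_t satisfies ∑_i 𝔼_{μ'_t}[u_i^p] = ∑_i 𝔼_μ[u_i^p] and ∑_j 𝔼_{μ'_t}[v_j^p] = ∑_j 𝔼_μ[v_j^p], then |∑_t λ_t · ∑_{i,j} 𝔼_{(μ'_t)^⊗}[(A i j)^q·((ũ_i ṽ_j)^{p−q} − (u_i v_j)^{p−q})]| ≤ (C₀/C^q)·(∑_{i,j}(A i j)^p)^{q/p}·((∑_i 𝔼_μ[u_i^p])·(∑_j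 𝔼_μ[v_j^p]))^{(p−q)/p}. -/

import Mathlib

open Finset

/-- A finitely supported probability measure on `X`, given by a finite support
and a mass function. -/
structure FinDist (X : Type*) where
  supp : Finset X
  mass : X → ℝ
  nonneg : ∀ x, 0 ≤ mass x
  zero_out : ∀ x ∉ supp, mass x = 0
  total : ∑ x ∈ supp, mass x = 1

/-- Expectation of a real-valued function. -/
noncomputable def FinDist.exp {X : Type*} (μ : FinDist X) (f : X → ℝ) : ℝ :=
  ∑ x ∈ μ.supp, μ.mass x * f x

/-- Expectation, under the product of the single-coordinate marginals `ν^⊗`,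
of a function `F (g x) (h y)` of two distinct coordinates `g` and `h`
(two distinct coordinates are independent under `ν^⊗`). -/
noncomputable def prodExp2 {X : Type*} (ν : FinDist X) (g h : X → ℝ)
    (F : ℝ → ℝ → ℝ) : ℝ :=
  ∑ x ∈ ν.supp, ∑ y ∈ ν.supp, ν.mass x * ν.mass y * F (g x) (h y)

/-- Truncation of a real value at threshold `thr`: keep it if `|a| ≤ thr`, else `0`. -/
noncomputable def truncVal (thr a : ℝ) : ℝ := if |a| ≤ thr then a else 0

/-- The truncation threshold `C·(𝔼_μ[u_i^p])^{1/p}` for the coordinate `u_i`. -/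
noncomputable def thrU {n m : ℕ} (μ : FinDist ((Fin n → ℝ) × (Fin m → ℝ)))
    (C : ℝ) (p : ℕ) (i : Fin n) : ℝ :=
  C * (μ.exp (fun x => x.1 i ^ p)) ^ ((1 : ℝ) / (p : ℝ))

/-- The truncation threshold `C·(𝔼_μ[v_j^p])^{1/p}` for the coordinate `v_j`. -/
noncomputable def thrV {n m : ℕ} (μ : FinDist ((Fin n → ℝ) × (Fin m → ℝ)))
    (C : ℝ) (p : ℕ) (j : Fin m) : ℝ :=
  C * (μ.exp (fun x => x.2 j ^ p)) ^ ((1 : ℝ) / (p : ℝ))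


lemma aux_holder {K : Type*} (S : Finset K) (w e a b D : K → ℝ) (p q : ℕ)
    (hp : Even p) (hq : 1 ≤ q) (hqp : q < p)
    (hw : ∀ k ∈ S, 0 ≤ w k) (he : ∀ k ∈ S, 0 ≤ e k)
    (he1 : ∀ k ∈ S, e k = 0 ∨ e k = 1)
    (hD : ∀ k ∈ S, |D k| ≤ e k * |b k| ^ (p - q)) :
    |∑ k ∈ S, w k * (a k ^ q * D k)| ≤
      (∑ k ∈ S, w k * (e k * a k ^ p)) ^ ((q : ℝ) / (p : ℝ)) *
      (∑ k ∈ S, w k * b k ^ p) ^ (((p : ℝ) - (q : ℝ)) / (p : ℝ)) := by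
  have hq0 : (0 : ℝ) < q := by exact_mod_cast hq
  have hqp' : (q : ℝ) < p := by exact_mod_cast hqp
  have hp0 : (0 : ℝ) < p := hq0.trans hqp'
  have hr0 : (0 : ℝ) < (p : ℝ) - q := by linarith
  have hcast : ((p - q : ℕ) : ℝ) = (p : ℝ) - q := by
    rw [Nat.cast_sub hqp.le]
  have hconj : Real.HolderConjugate ((p : ℝ) / q) ((p : ℝ) / ((p : ℝ) - q)) := by
    rw [Real.holderConjugate_iff]
    constructor
    · rw [lt_div_iff₀ hq0]; linarith
    · field_simp; ring
  have H := Real.inner_le_Lp_mul_Lq_of_nonneg S hconj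
    (f := fun k => w k ^ ((q : ℝ) / p) * (e k * |a k| ^ q))
    (g := fun k => w k ^ (((p : ℝ) - q) / p) * (|b k| ^ (p - q)))
    (fun k hk => by have := hw k hk; have := he k hk; positivity)
    (fun k hk => by have := hw k hk; have := he k hk; positivity)
  have e1 : ∀ k ∈ S, (w k ^ ((q : ℝ) / p) * (e k * |a k| ^ q)) ^ ((p : ℝ) / q)
      = w k * (e k * a k ^ p) := by
    intro k hk
    have h1 := hw k hk
    have h2 := he k hk
    rw [Real.mul_rpow (by positivity) (by positivity), ← Real.rpow_mul h1,
      Real.mul_rpow h2 (by positivity), ← Real.rpow_natCast (|a k|) q,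
      ← Real.rpow_mul (abs_nonneg _)]
    have : (q : ℝ) / p * (p / q) = 1 := by field_simp
    rw [this, Real.rpow_one]
    have : (q : ℝ) * (p / q) = p := by field_simp
    rw [this, Real.rpow_natCast, hp.pow_abs]
    rcases he1 k hk with h | h
    · rw [h, Real.zero_rpow (by positivity)]
    · rw [h, Real.one_rpow]
  have e2 : ∀ k ∈ S, (w k ^ (((p : ℝ) - q) / p) * (|b k| ^ (p - q))) ^ ((p : ℝ) / ((p : ℝ) - q))
      = w k * b k ^ p := by
    intro k hk
    have h1 := hw k hk
    rw [Real.mul_rpow (by positivity) (by positivity), ← Real.rpow_mul h1,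
      ← Real.rpow_natCast (|b k|) (p - q), hcast,
      ← Real.rpow_mul (abs_nonneg _)]
    have : ((p : ℝ) - q) / p * (p / (p - q)) = 1 := by field_simp
    rw [this, Real.rpow_one]
    have : ((p : ℝ) - q) * (p / (p - q)) = p := by field_simp
    rw [this, Real.rpow_natCast, hp.pow_abs]
  rw [Finset.sum_congr rfl e1, Finset.sum_congr rfl e2, one_div_div, one_div_div] at H
  refine le_trans ?_ H
  refine (Finset.abs_sum_le_sum_abs _ _).trans (Finset.sum_le_sum fun k hk => ?_)
  have h1 := hw k hk
  have h2 := he k hk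
  have hww : w k ^ ((q : ℝ) / p) * w k ^ (((p : ℝ) - q) / p) = w k := by
    rw [← Real.rpow_add_of_nonneg h1 (by positivity) (by positivity)]
    have : (q : ℝ) / p + ((p : ℝ) - q) / p = 1 := by field_simp; ring
    rw [this, Real.rpow_one]
  calc |w k * (a k ^ q * D k)| = w k * (|a k| ^ q * |D k|) := by
        rw [abs_mul, abs_mul, abs_pow, abs_of_nonneg h1]
    _ ≤ w k * (|a k| ^ q * (e k * |b k| ^ (p - q))) := by
        gcongr; exact hD k hk
    _ = (w k ^ ((q : ℝ) / p) * w k ^ (((p : ℝ) - q) / p)) *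
          (|a k| ^ q * (e k * |b k| ^ (p - q))) := by rw [hww]
    _ = _ := by ring

/-- tail indicator -/
noncomputable def tailInd (thr a : ℝ) : ℝ := if |a| ≤ thr then 0 else 1

noncomputable def tailOr (s t a b : ℝ) : ℝ := if |a| ≤ s ∧ |b| ≤ t then 0 else 1

lemma tailOr_cases (s t a b : ℝ) : tailOr s t a b = 0 ∨ tailOr s t a b = 1 := by
  unfold tailOr; split_ifs <;> simp

lemma tailOr_nonneg (s t a b : ℝ) : 0 ≤ tailOr s t a b := by
  rcases tailOr_cases s t a b with h | h <;> simp [h]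

lemma tailOr_le (s t a b : ℝ) : tailOr s t a b ≤ tailInd s a + tailInd t b := by
  unfold tailOr tailInd; split_ifs <;> simp_all

lemma trunc_diff (s t a b : ℝ) (r : ℕ) (hr : r ≠ 0) :
    |(truncVal s a * truncVal t b) ^ r - (a * b) ^ r| ≤ tailOr s t a b * |a * b| ^ r := by
  unfold truncVal tailOr
  by_cases h1 : |a| ≤ s <;> by_cases h2 : |b| ≤ t <;> simp [h1, h2, hr, abs_mul]

lemma exp_sum_nonneg {X : Type*} (μ : FinDist X) (f : X → ℝ) (h : ∀ x, 0 ≤ f x) :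
    0 ≤ μ.exp f := Finset.sum_nonneg fun x _ => mul_nonneg (μ.nonneg x) (h x)

lemma exp_mono' {X : Type*} (μ : FinDist X) (f g : X → ℝ) (h : ∀ x, f x ≤ g x) :
    μ.exp f ≤ μ.exp g :=
  Finset.sum_le_sum fun x _ => mul_le_mul_of_nonneg_left (h x) (μ.nonneg x)

lemma exp_mul_left {X : Type*} (μ : FinDist X) (c : ℝ) (f : X → ℝ) :
    μ.exp (fun x => c * f x) = c * μ.exp f := by
  unfold FinDist.exp; rw [Finset.mul_sum]; exact Finset.sum_congr rfl fun x _ => by ring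

lemma markov_tail {X : Type*} (μ : FinDist X) (f : X → ℝ) (C : ℝ) (hC : 0 < C) (p : ℕ)
    (hp0 : p ≠ 0) (hp : Even p) :
    μ.exp (fun x => tailInd (C * (μ.exp (fun x => f x ^ p)) ^ ((1 : ℝ) / (p : ℝ))) (f x))
      ≤ 1 / C ^ p := by
  set M := μ.exp (fun x => f x ^ p) with hM
  have hM0 : 0 ≤ M := exp_sum_nonneg _ _ fun x => hp.pow_nonneg _
  have hpow : (C * M ^ ((1 : ℝ) / (p : ℝ))) ^ p = C ^ p * M := by
    rw [mul_pow, one_div, Real.rpow_inv_natCast_pow hM0 hp0]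
  rcases hM0.eq_or_lt with h0 | hpos
  · have : μ.exp (fun x => tailInd (C * M ^ ((1 : ℝ) / (p : ℝ))) (f x)) = 0 := by
      refine Finset.sum_eq_zero fun x hx => ?_
      have hz := (Finset.sum_eq_zero_iff_of_nonneg
        (fun x _ => mul_nonneg (μ.nonneg x) (hp.pow_nonneg (f x)))).1
        (hM.symm.trans h0.symm) x hx
      rcases mul_eq_zero.1 hz with h | h
      · simp [h]
      · have : f x = 0 := pow_eq_zero_iff hp0 |>.1 h
        have h3 : 0 ≤ C * M ^ ((1 : ℝ) / (p : ℝ)) := by positivity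
        simp only [tailInd, this, abs_zero, if_pos h3, mul_zero]
    rw [this]; positivity
  · have hpt : ∀ x, tailInd (C * M ^ ((1 : ℝ) / (p : ℝ))) (f x) ≤ (1 / (C ^ p * M)) * f x ^ p := by
      intro x
      unfold tailInd
      split_ifs with h
      · have := hp.pow_nonneg (f x); positivity
      · push Not at h
        have h4 := pow_le_pow_left₀ (by positivity) h.le p
        rw [hpow, hp.pow_abs] at h4
        rw [one_div_mul_eq_div, le_div_iff₀ (by positivity)]; linarith
    refine (exp_mono' μ _ _ hpt).trans ?_
    rw [exp_mul_left, ← hM]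
    apply le_of_eq; field_simp

lemma final_bound (q p : ℕ) (C P T B : ℝ) (hC : 0 < C) (hq : 1 ≤ q) (hqp : q < p) (hP : 0 ≤ P)
    (hT0 : 0 ≤ T) (hT : T ≤ 2 / C ^ p * P) (hB : 0 ≤ B) :
    T ^ ((q : ℝ) / (p : ℝ)) * B ≤ 2 / C ^ q * P ^ ((q : ℝ) / (p : ℝ)) * B := by
  have hp0 : (0 : ℝ) < p := by exact_mod_cast (by omega : 0 < p)
  have hqp' : (q : ℝ) ≤ p := by exact_mod_cast hqp.le
  gcongr
  refine (Real.rpow_le_rpow hT0 hT (by positivity)).trans ?_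
  rw [Real.mul_rpow (by positivity) hP, Real.div_rpow (by norm_num) (by positivity)]
  have : (C ^ p) ^ ((q : ℝ) / p) = C ^ q := by
    rw [← Real.rpow_natCast C p, ← Real.rpow_mul hC.le, ← Real.rpow_natCast C q]
    congr 1; field_simp
  rw [this]
  gcongr
  calc (2 : ℝ) ^ ((q : ℝ) / p) ≤ 2 ^ (1 : ℝ) :=
        Real.rpow_le_rpow_of_exponent_le (by norm_num) (by rw [div_le_one hp0]; exact hqp')
    _ = 2 := by simp

lemma exp_add' {X : Type*} (μ : FinDist X) (f g : X → ℝ) :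
    μ.exp (fun x => f x + g x) = μ.exp f + μ.exp g := by
  unfold FinDist.exp; rw [← Finset.sum_add_distrib]; exact Finset.sum_congr rfl fun x _ => by ring

lemma prodExp2_le {X : Type*} (ν : FinDist X) (g h : X → ℝ) (s t : ℝ) :
    prodExp2 ν g h (fun a b => tailOr s t a b) ≤
      ν.exp (fun x => tailInd s (g x)) + ν.exp (fun x => tailInd t (h x)) := by
  have : ν.exp (fun x => tailInd s (g x)) + ν.exp (fun x => tailInd t (h x)) =
      ∑ x ∈ ν.supp, ∑ y ∈ ν.supp, ν.mass x * ν.mass y * (tailInd s (g x) + tailInd t (h y)) := by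
    have e : ∀ x y, ν.mass x * ν.mass y * (tailInd s (g x) + tailInd t (h y)) =
      (ν.mass x * tailInd s (g x)) * ν.mass y + ν.mass x * (ν.mass y * tailInd t (h y)) := by
      intros; ring
    simp only [e, Finset.sum_add_distrib, ← Finset.mul_sum, ← Finset.sum_mul, ν.total,
      FinDist.exp, mul_one, one_mul]
  rw [this]
  exact Finset.sum_le_sum fun x _ => Finset.sum_le_sum fun y _ =>
    mul_le_mul_of_nonneg_left (tailOr_le _ _ _ _) (mul_nonneg (ν.nonneg x) (ν.nonneg y))

lemma prodExp2_mul {X : Type*} (ν : FinDist X) (g h : X → ℝ) (p : ℕ) :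
    prodExp2 ν g h (fun a b => (a * b) ^ p) =
      ν.exp (fun x => g x ^ p) * ν.exp (fun x => h x ^ p) := by
  unfold prodExp2 FinDist.exp
  rw [Finset.sum_mul_sum]
  exact Finset.sum_congr rfl fun x _ => Finset.sum_congr rfl fun y _ => by ring

lemma prodExp2_mul_left {X : Type*} (ν : FinDist X) (g h : X → ℝ) (c : ℝ) (F : ℝ → ℝ → ℝ) :
    prodExp2 ν g h (fun a b => F a b * c) = prodExp2 ν g h F * c := by
  unfold prodExp2
  simp only [Finset.sum_mul, mul_assoc]

/-- replacing `u_i, v_j` by their truncations `ũ_i, ṽ_j` incurs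
small error, both under the mixture components and (given marginal moment
constraints) under their products of marginals. -/
theorem stmt_13 :
    ∃ C₀ : ℝ, 1 ≤ C₀ ∧
      ∀ (n m : ℕ), 1 ≤ n → 1 ≤ m →
      ∀ (p q : ℕ), 2 ≤ p → Even p → 1 ≤ q → q ≤ p - 1 →
      ∀ (C : ℝ), 0 < C →
      ∀ (N : ℕ) (μ : FinDist ((Fin n → ℝ) × (Fin m → ℝ)))
        (lam : Fin N → ℝ) (μ' : Fin N → FinDist ((Fin n → ℝ) × (Fin m → ℝ))),
        (∀ t, 0 ≤ lam t) → (∑ t, lam t = 1) →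
        (∀ f : (Fin n → ℝ) × (Fin m → ℝ) → ℝ,
          FinDist.exp μ f = ∑ t, lam t * FinDist.exp (μ' t) f) →
      ∀ A : Fin n → Fin m → ℝ,
        (|∑ t, lam t * ∑ i, ∑ j,
            FinDist.exp (μ' t) (fun x => A i j ^ q *
              ((truncVal (thrU μ C p i) (x.1 i) * truncVal (thrV μ C p j) (x.2 j)) ^ (p - q)
                - (x.1 i * x.2 j) ^ (p - q)))|
          ≤ (C₀ / C ^ q) * (∑ i, ∑ j, A i j ^ p) ^ ((q : ℝ) / (p : ℝ))
              * (∑ i, ∑ j, FinDist.exp μ (fun x => (x.1 i * x.2 j) ^ p))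
                  ^ (((p : ℝ) - (q : ℝ)) / (p : ℝ))) ∧
        ((∀ t, ∑ i, FinDist.exp (μ' t) (fun x => x.1 i ^ p)
            = ∑ i, FinDist.exp μ (fun x => x.1 i ^ p)) →
         (∀ t, ∑ j, FinDist.exp (μ' t) (fun x => x.2 j ^ p)
            = ∑ j, FinDist.exp μ (fun x => x.2 j ^ p)) →
          |∑ t, lam t * ∑ i, ∑ j,
              prodExp2 (μ' t) (fun x => x.1 i) (fun x => x.2 j)
                (fun a b => A i j ^ q *
                  ((truncVal (thrU μ C p i) a * truncVal (thrV μ C p j) b) ^ (p - q)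
                    - (a * b) ^ (p - q)))|
            ≤ (C₀ / C ^ q) * (∑ i, ∑ j, A i j ^ p) ^ ((q : ℝ) / (p : ℝ))
                * ((∑ i, FinDist.exp μ (fun x => x.1 i ^ p))
                    * (∑ j, FinDist.exp μ (fun x => x.2 j ^ p)))
                      ^ (((p : ℝ) - (q : ℝ)) / (p : ℝ))) := by
  refine ⟨2, by norm_num, ?_⟩
  intro n m _ _ p q hp2 hp hq hqp' C hC N μ lam μ' hlam _ hmix A
  have hqp : q < p := by omega
  have hp0 : p ≠ 0 := by omega
  have hr : p - q ≠ 0 := by omega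
  have hPnn : 0 ≤ ∑ i, ∑ j, A i j ^ p :=
    Finset.sum_nonneg fun i _ => Finset.sum_nonneg fun j _ => hp.pow_nonneg _
  have mU : ∀ i, μ.exp (fun x => tailInd (thrU μ C p i) (x.1 i)) ≤ 1 / C ^ p :=
    fun i => markov_tail μ (fun x => x.1 i) C hC p hp0 hp
  have mV : ∀ j, μ.exp (fun x => tailInd (thrV μ C p j) (x.2 j)) ≤ 1 / C ^ p :=
    fun j => markov_tail μ (fun x => x.2 j) C hC p hp0 hp
  constructor
  · have hL : ∑ t, lam t * ∑ i, ∑ j,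
            FinDist.exp (μ' t) (fun x => A i j ^ q *
              ((truncVal (thrU μ C p i) (x.1 i) * truncVal (thrV μ C p j) (x.2 j)) ^ (p - q)
                - (x.1 i * x.2 j) ^ (p - q))) =
        ∑ i, ∑ j, FinDist.exp μ (fun x => A i j ^ q *
              ((truncVal (thrU μ C p i) (x.1 i) * truncVal (thrV μ C p j) (x.2 j)) ^ (p - q)
                - (x.1 i * x.2 j) ^ (p - q))) := by
      simp only [hmix, Finset.mul_sum]
      rw [Finset.sum_comm]
      exact Finset.sum_congr rfl fun i _ => Finset.sum_comm
    rw [hL]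
    have H := aux_holder (Finset.univ ×ˢ Finset.univ ×ˢ μ.supp)
      (fun k : Fin n × Fin m × ((Fin n → ℝ) × (Fin m → ℝ)) => μ.mass k.2.2)
      (fun k => tailOr (thrU μ C p k.1) (thrV μ C p k.2.1) (k.2.2.1 k.1) (k.2.2.2 k.2.1))
      (fun k => A k.1 k.2.1) (fun k => k.2.2.1 k.1 * k.2.2.2 k.2.1)
      (fun k => (truncVal (thrU μ C p k.1) (k.2.2.1 k.1) *
        truncVal (thrV μ C p k.2.1) (k.2.2.2 k.2.1)) ^ (p - q)
                - (k.2.2.1 k.1 * k.2.2.2 k.2.1) ^ (p - q)) p q hp hq hqp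
      (fun k _ => μ.nonneg _) (fun k _ => tailOr_nonneg _ _ _ _)
      (fun k _ => tailOr_cases _ _ _ _) (fun k _ => trunc_diff _ _ _ _ _ hr)
    simp only [Finset.sum_product] at H
    refine H.trans ?_
    refine final_bound q p C _ _ _ hC hq hqp hPnn ?_ ?_ ?_
    · exact Finset.sum_nonneg fun i _ => Finset.sum_nonneg fun j _ => Finset.sum_nonneg fun x _ =>
        mul_nonneg (μ.nonneg _) (mul_nonneg (tailOr_nonneg _ _ _ _) (hp.pow_nonneg _))
    · simp only [Finset.mul_sum]
      refine Finset.sum_le_sum fun i _ => Finset.sum_le_sum fun j _ => ?_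
      simp only [← mul_assoc, ← Finset.sum_mul]
      refine mul_le_mul_of_nonneg_right ?_ (hp.pow_nonneg _)
      have h1 := exp_mono' μ _ _ (fun x => tailOr_le (thrU μ C p i) (thrV μ C p j) (x.1 i) (x.2 j))
      rw [exp_add'] at h1
      have h2 := mU i
      have h3 := mV j
      have h4 : 2 / C ^ p = 1 / C ^ p + 1 / C ^ p := by ring
      rw [h4]
      exact h1.trans (add_le_add h2 h3)
    · refine Real.rpow_nonneg (Finset.sum_nonneg fun i _ => Finset.sum_nonneg fun j _ =>
        exp_sum_nonneg _ _ fun x => hp.pow_nonneg _) _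
  · intro hU hV
    have H := aux_holder (Finset.univ.sigma fun t : Fin N =>
        (Finset.univ : Finset (Fin n)) ×ˢ (Finset.univ : Finset (Fin m)) ×ˢ
          (μ' t).supp ×ˢ (μ' t).supp)
      (fun k => lam k.1 * ((μ' k.1).mass k.2.2.2.1 * (μ' k.1).mass k.2.2.2.2))
      (fun k => tailOr (thrU μ C p k.2.1) (thrV μ C p k.2.2.1)
        (k.2.2.2.1.1 k.2.1) (k.2.2.2.2.2 k.2.2.1))
      (fun k => A k.2.1 k.2.2.1) (fun k => k.2.2.2.1.1 k.2.1 * k.2.2.2.2.2 k.2.2.1)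
      (fun k => (truncVal (thrU μ C p k.2.1) (k.2.2.2.1.1 k.2.1) *
        truncVal (thrV μ C p k.2.2.1) (k.2.2.2.2.2 k.2.2.1)) ^ (p - q)
                - (k.2.2.2.1.1 k.2.1 * k.2.2.2.2.2 k.2.2.1) ^ (p - q)) p q hp hq hqp
      (fun k _ => mul_nonneg (hlam _) (mul_nonneg ((μ' _).nonneg _) ((μ' _).nonneg _)))
      (fun k _ => tailOr_nonneg _ _ _ _)
      (fun k _ => tailOr_cases _ _ _ _) (fun k _ => trunc_diff _ _ _ _ _ hr)
    simp only [Finset.sum_sigma, Finset.sum_product, mul_assoc (lam _), ← Finset.mul_sum] at H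
    have hB : ∑ t, lam t * ∑ i : Fin n, ∑ j : Fin m, ∑ x ∈ (μ' t).supp, ∑ y ∈ (μ' t).supp,
        (μ' t).mass x * (μ' t).mass y * (x.1 i * y.2 j) ^ p =
        (∑ i, FinDist.exp μ (fun x => x.1 i ^ p)) * (∑ j, FinDist.exp μ (fun x => x.2 j ^ p)) := by
      have : ∀ t, ∑ i : Fin n, ∑ j : Fin m, ∑ x ∈ (μ' t).supp, ∑ y ∈ (μ' t).supp,
        (μ' t).mass x * (μ' t).mass y * (x.1 i * y.2 j) ^ p =
        (∑ i, FinDist.exp μ (fun x => x.1 i ^ p)) *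
          (∑ j, FinDist.exp μ (fun x => x.2 j ^ p)) := by
        intro t
        rw [← hU t, ← hV t, Finset.sum_mul_sum]
        exact Finset.sum_congr rfl fun i _ => Finset.sum_congr rfl fun j _ =>
          prodExp2_mul (μ' t) (fun x => x.1 i) (fun x => x.2 j) p
      simp only [this, ← Finset.sum_mul]
      rw [‹∑ t, lam t = 1›, one_mul]
    rw [hB] at H
    refine H.trans ?_
    refine final_bound q p C _ _ _ hC hq hqp hPnn ?_ ?_ ?_
    · exact Finset.sum_nonneg fun t _ => mul_nonneg (hlam t) <|
        Finset.sum_nonneg fun i _ => Finset.sum_nonneg fun j _ => Finset.sum_nonneg fun x _ =>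
        Finset.sum_nonneg fun y _ =>
        mul_nonneg (mul_nonneg ((μ' t).nonneg _) ((μ' t).nonneg _))
          (mul_nonneg (tailOr_nonneg _ _ _ _) (hp.pow_nonneg _))
    · simp only [Finset.mul_sum]
      rw [Finset.sum_comm]
      refine Finset.sum_le_sum fun i _ => ?_
      rw [Finset.sum_comm]
      refine Finset.sum_le_sum fun j _ => ?_
      simp only [← mul_assoc, ← Finset.sum_mul]
      refine mul_le_mul_of_nonneg_right ?_ (hp.pow_nonneg _)
      simp only [mul_assoc (lam _), ← Finset.mul_sum]
      have h1 : ∀ t, lam t * _ ≤ lam t * _ := fun t => mul_le_mul_of_nonneg_left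
        (prodExp2_le (μ' t) (fun x => x.1 i) (fun x => x.2 j) (thrU μ C p i) (thrV μ C p j)) (hlam t)
      have h2 := mU i
      have h3 := mV j
      rw [hmix] at h2 h3
      have h4 : 2 / C ^ p = 1 / C ^ p + 1 / C ^ p := by ring
      rw [h4]
      refine le_trans (Finset.sum_le_sum fun t _ => h1 t) ?_
      simp only [mul_add, Finset.sum_add_distrib]
      exact add_le_add h2 h3
    · exact Real.rpow_nonneg (mul_nonneg
        (Finset.sum_nonneg fun i _ => exp_sum_nonneg _ _ fun x => hp.pow_nonneg _)
        (Finset.sum_nonneg fun i _ => exp_sum_nonneg _ _ fun x => hp.pow_nonneg _)) _
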